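/- Let r ≥ 1 be a fixed integer and t_1, ..., t_r > 0 be fixed real numbers. Then for z ≥ 3, the number of pairs of r-tuples ((k_1, ..., k_r), (j_1, ..., j_r)) of integers k_i, j_i ≥ 1 satisfying k_1 t_1 + ⋯ + k_r t_r ≤ z, j_1 t_1 + ⋯ + j_r t_r ≤ z, and gcd(k_i, j_i) = 1 for every 1 ≤ i ≤ r, equals (1/((r!)^2 (ζ(2))^r)) (∏_{i=1}^r 1/t_i^2) z^{2r} + O(z^{2r-1} log z). -/

import Mathlib

lemma mul_pow_mul_sub_le_pow_sub_pow {a b : ℝ} (hb : 0 ≤ b) (hab : b ≤ a) (n : ℕ) :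
    (n + 1) * b ^ n * (a - b) ≤ a ^ (n + 1) - b ^ (n + 1) := by
  induction n with
  | zero => simp
  | succ n ih =>
    have h1 : b * ((n + 1) * b ^ n * (a - b)) ≤ a * (a ^ (n + 1) - b ^ (n + 1)) :=
      mul_le_mul hab ih (by have := sub_nonneg.2 hab; positivity) (hb.trans hab)
    push_cast
    linear_combination h1

lemma pow_sub_pow_le_mul_pow_mul_sub {a b : ℝ} (hb : 0 ≤ b) (hab : b ≤ a) (n : ℕ) :
    a ^ (n + 1) - b ^ (n + 1) ≤ (n + 1) * a ^ n * (a - b) := by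
  induction n with
  | zero => simp
  | succ n ih =>
    have h1 := mul_le_mul_of_nonneg_left ih (hb.trans hab)
    have h2 : b ^ (n + 1) * (a - b) ≤ a ^ (n + 1) * (a - b) :=
      mul_le_mul_of_nonneg_right (by gcongr) (sub_nonneg.2 hab)
    push_cast
    linear_combination h1 + h2

lemma sum_Icc_sub_mul_pow_bounds (r : ℕ) {x s : ℝ} (hs : 0 < s) (K : ℕ) (hK : K * s ≤ x) :
    (r + 1) * s * ∑ k ∈ Finset.Icc 1 K, (x - k * s) ^ r ≤ x ^ (r + 1) - (x - K * s) ^ (r + 1) ∧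
    x ^ (r + 1) - (x - K * s) ^ (r + 1) ≤
      (r + 1) * s * (∑ k ∈ Finset.Icc 1 K, (x - k * s) ^ r + x ^ r - (x - K * s) ^ r) := by
  induction K with
  | zero => simp
  | succ K ih =>
    push_cast at hK ⊢
    obtain ⟨h1, h2⟩ := ih (by linarith)
    rw [Finset.sum_Icc_succ_top (by omega)]
    push_cast
    have hb : 0 ≤ x - (K + 1) * s := by linarith
    have hab : x - (K + 1) * s ≤ x - K * s := by linarith
    have h3 := mul_pow_mul_sub_le_pow_sub_pow hb hab r
    have h4 := pow_sub_pow_le_mul_pow_mul_sub hb hab r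
    constructor
    · linear_combination h1 + h3
    · linear_combination h2 + h4

lemma sum_Icc_floor_sub_mul_pow_bounds (r : ℕ) {x s : ℝ} (hx : 0 ≤ x) (hs : 0 < s) :
    ∑ k ∈ Finset.Icc 1 ⌊x / s⌋₊, (x - k * s) ^ r ≤ x ^ (r + 1) / ((r + 1) * s) ∧
    x ^ (r + 1) / ((r + 1) * s) ≤ ∑ k ∈ Finset.Icc 1 ⌊x / s⌋₊, (x - k * s) ^ r + x ^ r := by
  set K := ⌊x / s⌋₊
  have hK : K * s ≤ x := (le_div_iff₀ hs).1 (Nat.floor_le (by positivity))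
  have hK' : x - K * s ≤ s := by
    have := (div_lt_iff₀ hs).1 (Nat.lt_floor_add_one (x / s))
    linarith
  obtain ⟨h1, h2⟩ := sum_Icc_sub_mul_pow_bounds r hs K hK
  have hb : 0 ≤ x - K * s := by linarith
  have hp : 0 ≤ (x - K * s) ^ r := by positivity
  constructor
  · rw [le_div_iff₀ (by positivity)]
    have : 0 ≤ (x - K * s) ^ (r + 1) := by positivity
    linarith
  · rw [div_le_iff₀ (by positivity)]
    have h3 : (x - K * s) ^ (r + 1) ≤ (r + 1) * s * (x - K * s) ^ r := by
      rw [pow_succ]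
      have : (1 : ℝ) ≤ r + 1 := by simp
      calc (x - K * s) ^ r * (x - K * s) ≤ (x - K * s) ^ r * s := by gcongr
        _ ≤ (r + 1) * ((x - K * s) ^ r * s) := le_mul_of_one_le_left (by positivity) this
        _ = _ := by ring
    linarith

open ArithmeticFunction in
lemma sum_Icc_moebius_of_dvd {k j D : ℕ} (hk : k ∈ Finset.Icc 1 D) :
    (∑ d ∈ Finset.Icc 1 D, if d ∣ k ∧ d ∣ j then (moebius d : ℝ) else 0) =
      if k.Coprime j then 1 else 0 := by
  rw [Finset.mem_Icc] at hk
  have h : (Finset.Icc 1 D).filter (fun d ↦ d ∣ k ∧ d ∣ j) = (k.gcd j).divisors := by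
    ext d
    simp only [Finset.mem_filter, Finset.mem_Icc, Nat.mem_divisors, Nat.dvd_gcd_iff]
    constructor
    · rintro ⟨-, h⟩
      exact ⟨h, Nat.gcd_ne_zero_left (by omega)⟩
    · rintro ⟨h, -⟩
      exact ⟨⟨Nat.pos_of_dvd_of_pos h.1 hk.1, (Nat.le_of_dvd hk.1 h.1).trans hk.2⟩, h⟩
  rw [← Finset.sum_filter, h]
  have h2 := congrArg (fun f : ArithmeticFunction ℤ ↦ (f (k.gcd j) : ℝ)) coe_zeta_mul_moebius
  simp only [coe_zeta_mul_apply, one_apply] at h2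
  push_cast at h2
  simpa [Nat.Coprime] using h2

lemma sum_Icc_ite_dvd (X : ℕ) {d : ℕ} (hd : 0 < d) (f : ℕ → ℝ) :
    (∑ k ∈ Finset.Icc 1 X, if d ∣ k then f k else 0) = ∑ k ∈ Finset.Icc 1 (X / d), f (d * k) := by
  rw [← Finset.sum_filter]
  symm
  refine Finset.sum_bij (fun k _ ↦ d * k) ?_ ?_ ?_ (fun _ _ ↦ rfl)
  · intro k hk
    simp only [Finset.mem_Icc, Finset.mem_filter, Nat.le_div_iff_mul_le hd] at hk ⊢
    exact ⟨⟨Nat.mul_pos hd hk.1, by linarith⟩, dvd_mul_right _ _⟩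
  · intro a _ b _ h
    exact Nat.eq_of_mul_eq_mul_left hd h
  · intro b hb
    simp only [Finset.mem_Icc, Finset.mem_filter] at hb
    obtain ⟨⟨h1, h2⟩, c, rfl⟩ := hb
    refine ⟨c, ?_, rfl⟩
    rw [Finset.mem_Icc, Nat.le_div_iff_mul_le hd]
    exact ⟨Nat.pos_of_mul_pos_left h1, by linarith⟩

open ArithmeticFunction in
lemma sum_coprime_mul_eq_sum_moebius {X Y D : ℕ} (hX : X ≤ D) (f g : ℕ → ℝ) :
    ∑ p ∈ (Finset.Icc 1 X ×ˢ Finset.Icc 1 Y).filter (fun p ↦ p.1.Coprime p.2), f p.1 * g p.2 =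
      ∑ d ∈ Finset.Icc 1 D, (moebius d : ℝ) *
        ((∑ k ∈ Finset.Icc 1 (X / d), f (d * k)) * ∑ j ∈ Finset.Icc 1 (Y / d), g (d * j)) := by
  rw [Finset.sum_filter]
  have h1 : ∀ p ∈ Finset.Icc 1 X ×ˢ Finset.Icc 1 Y,
      (if p.1.Coprime p.2 then f p.1 * g p.2 else 0) =
        ∑ d ∈ Finset.Icc 1 D, (moebius d : ℝ) *
          ((if d ∣ p.1 then f p.1 else 0) * if d ∣ p.2 then g p.2 else 0) := by
    intro p hp
    rw [Finset.mem_product] at hp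
    rw [← mul_boole, ← sum_Icc_moebius_of_dvd (Finset.Icc_subset_Icc_right hX hp.1),
      Finset.mul_sum]
    refine Finset.sum_congr rfl fun d _ ↦ ?_
    by_cases h : d ∣ p.1 <;> by_cases h' : d ∣ p.2 <;> simp [h, h', mul_comm]
  rw [Finset.sum_congr rfl h1, Finset.sum_comm]
  refine Finset.sum_congr rfl fun d hd ↦ ?_
  have hd' : 0 < d := (Finset.mem_Icc.1 hd).1
  rw [← Finset.mul_sum, ← sum_Icc_ite_dvd X hd', ← sum_Icc_ite_dvd Y hd', Finset.sum_mul_sum,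
    Finset.sum_product]

open ArithmeticFunction in
lemma hasSum_moebius_div_sq :
    HasSum (fun d : ℕ ↦ (moebius d : ℝ) / (d : ℝ) ^ 2) (Real.pi ^ 2 / 6)⁻¹ := by
  have hs : (1 : ℝ) < (2 : ℂ).re := by norm_num
  have h1 := (LSeriesSummable_moebius_iff.2 hs).hasSum
  have h2 := LSeries_zeta_mul_Lseries_moebius hs
  rw [LSeries_zeta_eq_riemannZeta hs, riemannZeta_two] at h2
  have h3 := eq_inv_of_mul_eq_one_right h2
  rw [LSeries] at h3
  rw [h3] at h1
  rw [← Complex.hasSum_ofReal]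
  convert! h1 using 1
  · ext d
    rcases eq_or_ne d 0 with rfl | hd
    · simp
    · rw [LSeries.term_of_ne_zero hd]
      norm_cast
  · push_cast
    rfl

open ArithmeticFunction in
lemma abs_sum_moebius_div_sq_sub_le (D : ℕ) :
    |∑ d ∈ Finset.Icc 1 D, (moebius d : ℝ) / (d : ℝ) ^ 2 - (Real.pi ^ 2 / 6)⁻¹| ≤
      2 / (D + 1 : ℝ) := by
  have h := (hasSum_moebius_div_sq.tendsto_sum_nat.const_sub
    (∑ d ∈ Finset.Icc 1 D, (moebius d : ℝ) / (d : ℝ) ^ 2)).abs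
  refine le_of_tendsto h (Filter.eventually_atTop.2 ⟨D + 1, fun n hn ↦ ?_⟩)
  have h1 : ∑ d ∈ Finset.range n, (moebius d : ℝ) / (d : ℝ) ^ 2 =
      ∑ d ∈ Finset.Icc 1 D, (moebius d : ℝ) / (d : ℝ) ^ 2 +
        ∑ d ∈ Finset.Ioo D n, (moebius d : ℝ) / (d : ℝ) ^ 2 := by
    have hr : Finset.range n = insert 0 (Finset.Icc 1 D ∪ Finset.Ioo D n) := by
      ext d
      simp only [Finset.mem_range, Finset.mem_insert, Finset.mem_union, Finset.mem_Icc,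
        Finset.mem_Ioo]
      omega
    rw [hr, Finset.sum_insert (by simp), Finset.sum_union]
    · simp
    · rw [Finset.disjoint_left]
      intro d
      simp only [Finset.mem_Icc, Finset.mem_Ioo]
      omega
  rw [h1, sub_add_cancel_left, abs_neg]
  refine (Finset.abs_sum_le_sum_abs _ _).trans (le_trans ?_ (sum_Ioo_inv_sq_le D n))
  refine Finset.sum_le_sum fun d _ ↦ ?_
  rw [abs_div, abs_of_nonneg (sq_nonneg (d : ℝ)), div_eq_mul_inv]
  refine mul_le_of_le_one_left (by positivity) ?_
  exact_mod_cast abs_moebius_le_one (n := d)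

lemma sum_Icc_floor_inv_le {t M : ℝ} (ht : 0 < t) (hM : 3 ≤ M) :
    ∑ d ∈ Finset.Icc 1 ⌊M / t⌋₊, (d : ℝ)⁻¹ ≤ (2 + |Real.log t|) * Real.log M := by
  have hlog : 1 ≤ Real.log M := by
    rw [Real.le_log_iff_exp_le (by linarith)]
    linarith [Real.exp_one_lt_three]
  have h1 := harmonic_le_one_add_log ⌊M / t⌋₊
  rw [harmonic_eq_sum_Icc] at h1
  push_cast at h1
  have h2 : Real.log ⌊M / t⌋₊ ≤ Real.log M + |Real.log t| := by
    rcases Nat.eq_zero_or_pos ⌊M / t⌋₊ with h | h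
    · rw [h, Nat.cast_zero, Real.log_zero]
      positivity
    · calc Real.log ⌊M / t⌋₊ ≤ Real.log (M / t) :=
            Real.log_le_log (by exact_mod_cast h) (Nat.floor_le (by positivity))
        _ = Real.log M - Real.log t := Real.log_div (by linarith) ht.ne'
        _ ≤ _ := by linarith [neg_abs_le (Real.log t)]
  nlinarith [abs_nonneg (Real.log t)]

lemma abs_sum_mul_sum_sub_le (r : ℕ) {x y M s : ℝ} (hx : 0 ≤ x) (hy : 0 ≤ y) (hxM : x ≤ M)
    (hyM : y ≤ M) (hs : 0 < s) :
    |(∑ k ∈ Finset.Icc 1 ⌊x / s⌋₊, (x - k * s) ^ r) *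
        (∑ j ∈ Finset.Icc 1 ⌊y / s⌋₊, (y - j * s) ^ r) -
      x ^ (r + 1) / ((r + 1) * s) * (y ^ (r + 1) / ((r + 1) * s))| ≤
      2 * M ^ (2 * r + 1) / s := by
  have hM : 0 ≤ M := hx.trans hxM
  have key : ∀ u : ℝ, 0 ≤ u → u ≤ M →
      0 ≤ ∑ k ∈ Finset.Icc 1 ⌊u / s⌋₊, (u - k * s) ^ r ∧ u ^ r ≤ M ^ r ∧
      u ^ (r + 1) / ((r + 1) * s) ≤ M ^ (r + 1) / s := by
    intro u hu huM
    refine ⟨Finset.sum_nonneg fun k hk ↦ pow_nonneg ?_ r, by gcongr, ?_⟩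
    · rw [Finset.mem_Icc, Nat.le_floor_iff (by positivity), le_div_iff₀ hs] at hk
      linarith [hk.2]
    · have : s ≤ (r + 1) * s := le_mul_of_one_le_left hs.le (by simp)
      gcongr
  obtain ⟨hS1, hxr, hV1⟩ := key x hx hxM
  obtain ⟨hS2, hyr, hV2⟩ := key y hy hyM
  obtain ⟨a1, a2⟩ := sum_Icc_floor_sub_mul_pow_bounds r hx hs
  obtain ⟨b1, b2⟩ := sum_Icc_floor_sub_mul_pow_bounds r hy hs
  set S1 := ∑ k ∈ Finset.Icc 1 ⌊x / s⌋₊, (x - k * s) ^ r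
  set S2 := ∑ k ∈ Finset.Icc 1 ⌊y / s⌋₊, (y - k * s) ^ r
  set V1 := x ^ (r + 1) / ((r + 1) * s)
  set V2 := y ^ (r + 1) / ((r + 1) * s)
  have hle : S1 * S2 ≤ V1 * V2 := mul_le_mul a1 b1 hS2 (hS1.trans a1)
  rw [abs_sub_comm, abs_of_nonneg (sub_nonneg.2 hle)]
  have hMr : 0 ≤ M ^ r := by positivity
  have h1 : V1 * (V2 - S2) ≤ M ^ (r + 1) / s * M ^ r :=
    mul_le_mul hV1 (by linarith) (by linarith) (by positivity)
  have h2 : S2 * (V1 - S1) ≤ M ^ (r + 1) / s * M ^ r :=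
    mul_le_mul (b1.trans hV2) (by linarith) (by linarith) (by positivity)
  calc V1 * V2 - S1 * S2 = V1 * (V2 - S2) + S2 * (V1 - S1) := by ring
    _ ≤ M ^ (r + 1) / s * M ^ r + M ^ (r + 1) / s * M ^ r := add_le_add h1 h2
    _ = _ := by ring

open ArithmeticFunction in
lemma abs_sum_coprime_pow_mul_pow_sub_le (r : ℕ) {t x y M : ℝ} (ht : 0 < t) (hM : 3 ≤ M)
    (hx : 0 ≤ x) (hy : 0 ≤ y) (hxM : x ≤ M) (hyM : y ≤ M) :
    |∑ p ∈ (Finset.Icc 1 ⌊x / t⌋₊ ×ˢ Finset.Icc 1 ⌊y / t⌋₊).filter (fun p ↦ p.1.Coprime p.2),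
        (x - p.1 * t) ^ r * (y - p.2 * t) ^ r -
      (Real.pi ^ 2 / 6)⁻¹ / ((r + 1) ^ 2 * t ^ 2) * (x ^ (r + 1) * y ^ (r + 1))| ≤
      2 / t * (3 + |Real.log t|) * (M ^ (2 * r + 1) * Real.log M) := by
  set D := ⌊M / t⌋₊ with hD
  have hlog : 1 ≤ Real.log M := by
    rw [Real.le_log_iff_exp_le (by linarith)]
    linarith [Real.exp_one_lt_three]
  rw [sum_coprime_mul_eq_sum_moebius (D := D) (Nat.floor_le_floor (by gcongr))
    (fun k ↦ (x - k * t) ^ r) (fun j ↦ (y - j * t) ^ r)]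
  set S := ∑ d ∈ Finset.Icc 1 D, (moebius d : ℝ) *
    ((∑ k ∈ Finset.Icc 1 (⌊x / t⌋₊ / d), (x - (d * k : ℕ) * t) ^ r) *
      ∑ j ∈ Finset.Icc 1 (⌊y / t⌋₊ / d), (y - (d * j : ℕ) * t) ^ r)
  set A := x ^ (r + 1) * y ^ (r + 1) / ((r + 1) ^ 2 * t ^ 2)
  have h1 : |S - A * ∑ d ∈ Finset.Icc 1 D, (moebius d : ℝ) / (d : ℝ) ^ 2| ≤
      2 / t * M ^ (2 * r + 1) * ((2 + |Real.log t|) * Real.log M) := by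
    refine le_trans ?_ (mul_le_mul_of_nonneg_left (sum_Icc_floor_inv_le ht hM) (by positivity))
    rw [Finset.mul_sum, Finset.mul_sum, ← Finset.sum_sub_distrib]
    refine (Finset.abs_sum_le_sum_abs _ _).trans (Finset.sum_le_sum fun d hd ↦ ?_)
    have hd0 : 0 < (d : ℝ) := by exact_mod_cast (Finset.mem_Icc.1 hd).1
    have h := abs_sum_mul_sum_sub_le r hx hy hxM hyM (s := t * d) (by positivity)
    rw [← div_div, ← div_div, Nat.floor_div_natCast, Nat.floor_div_natCast] at h
    have hμ : |(moebius d : ℝ)| ≤ 1 := by exact_mod_cast abs_moebius_le_one (n := d)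
    refine le_trans (le_trans (le_of_eq ?_) (mul_le_of_le_one_left (abs_nonneg _) hμ))
      (h.trans_eq ?_)
    · rw [← abs_mul]
      congr 1
      have e : ∀ (u : ℝ) (k : ℕ), u - (d * k : ℕ) * t = u - k * (t * d) := by
        intro u k
        push_cast
        ring
      simp only [e, A]
      generalize ∑ k ∈ Finset.Icc 1 (⌊x / t⌋₊ / d), (x - k * (t * d)) ^ r = S1
      generalize ∑ j ∈ Finset.Icc 1 (⌊y / t⌋₊ / d), (y - j * (t * d)) ^ r = S2
      field_simp
    · field_simp
  have h2 : |A * (∑ d ∈ Finset.Icc 1 D, (moebius d : ℝ) / (d : ℝ) ^ 2 - (Real.pi ^ 2 / 6)⁻¹)| ≤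
      2 / t * M ^ (2 * r + 1) := by
    have hA0 : 0 ≤ A := by positivity
    have hA : A ≤ M ^ (r + 1) * M ^ (r + 1) / t ^ 2 := by
      have : t ^ 2 ≤ (r + 1) ^ 2 * t ^ 2 :=
        le_mul_of_one_le_left (by positivity) (one_le_pow₀ (by simp))
      simp only [A]
      gcongr
    have hDM : M / t ≤ D + 1 := (Nat.lt_floor_add_one _).le
    have hM0 : 0 < M := by linarith
    rw [abs_mul, abs_of_nonneg hA0]
    calc _ ≤ M ^ (r + 1) * M ^ (r + 1) / t ^ 2 * (2 / (M / t)) :=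
          mul_le_mul hA ((abs_sum_moebius_div_sq_sub_le D).trans (by gcongr)) (abs_nonneg _)
            (by positivity)
      _ = _ := by field_simp; ring
  have h3 : 2 / t * M ^ (2 * r + 1) ≤ 2 / t * M ^ (2 * r + 1) * Real.log M :=
    le_mul_of_one_le_right (by positivity) hlog
  calc _ = |(S - A * ∑ d ∈ Finset.Icc 1 D, (moebius d : ℝ) / (d : ℝ) ^ 2) +
        A * (∑ d ∈ Finset.Icc 1 D, (moebius d : ℝ) / (d : ℝ) ^ 2 - (Real.pi ^ 2 / 6)⁻¹)| := by
        congr 1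
        simp only [A]
        ring
    _ ≤ _ := abs_add_le _ _
    _ ≤ 2 / t * M ^ (2 * r + 1) * ((2 + |Real.log t|) * Real.log M) +
        2 / t * M ^ (2 * r + 1) * Real.log M := add_le_add h1 (h2.trans h3)
    _ = _ := by ring

/-- Pairs of `r`-tuples of positive integers, coprime in each coordinate, whose weighted sums are
at most `x` and `y` respectively. -/
def coprimePairs {r : ℕ} (t : Fin r → ℝ) (x y : ℝ) : Set ((Fin r → ℕ) × (Fin r → ℕ)) :=
  {kj | (∀ i, 1 ≤ kj.1 i) ∧ (∀ i, 1 ≤ kj.2 i) ∧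
    (∑ i, (kj.1 i : ℝ) * t i) ≤ x ∧ (∑ i, (kj.2 i : ℝ) * t i) ≤ y ∧
    ∀ i, Nat.Coprime (kj.1 i) (kj.2 i)}

lemma le_floor_div_of_sum_mul_le {r : ℕ} {t : Fin r → ℝ} (ht : ∀ i, 0 < t i) {k : Fin r → ℕ}
    {x : ℝ} (h : ∑ i, (k i : ℝ) * t i ≤ x) (i : Fin r) : k i ≤ ⌊x / t i⌋₊ := by
  refine Nat.le_floor ((le_div_iff₀ (ht i)).2 (le_trans ?_ h))
  exact Finset.single_le_sum (f := fun i ↦ (k i : ℝ) * t i)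
    (fun j _ ↦ mul_nonneg (Nat.cast_nonneg _) (ht j).le) (Finset.mem_univ i)

lemma coprimePairs_finite {r : ℕ} {t : Fin r → ℝ} (ht : ∀ i, 0 < t i) (x y : ℝ) :
    (coprimePairs t x y).Finite :=
  ((Set.finite_Iic fun i ↦ ⌊x / t i⌋₊).prod (Set.finite_Iic fun i ↦ ⌊y / t i⌋₊)).subset
    fun _ h ↦ ⟨le_floor_div_of_sum_mul_le ht h.2.2.1, le_floor_div_of_sum_mul_le ht h.2.2.2.1⟩

lemma cons_mem_coprimePairs_iff {r : ℕ} {t : Fin (r + 1) → ℝ} {x y : ℝ} {a b : ℕ}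
    {k j : Fin r → ℕ} :
    (Fin.cons a k, Fin.cons b j) ∈ coprimePairs t x y ↔
      (1 ≤ a ∧ 1 ≤ b ∧ a.Coprime b) ∧
        (k, j) ∈ coprimePairs (Fin.tail t) (x - a * t 0) (y - b * t 0) := by
  simp only [coprimePairs, Set.mem_ofPred_eq, Fin.forall_fin_succ, Fin.cons_zero, Fin.cons_succ,
    Fin.sum_univ_succ, Fin.tail, le_sub_iff_add_le']
  tauto

lemma ncard_coprimePairs_succ {r : ℕ} {t : Fin (r + 1) → ℝ} (ht : ∀ i, 0 < t i) (x y : ℝ) :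
    (coprimePairs t x y).ncard =
      ∑ p ∈ (Finset.Icc 1 ⌊x / t 0⌋₊ ×ˢ Finset.Icc 1 ⌊y / t 0⌋₊).filter
        (fun p ↦ p.1.Coprime p.2),
        (coprimePairs (Fin.tail t) (x - p.1 * t 0) (y - p.2 * t 0)).ncard := by
  classical
  have hfin := coprimePairs_finite ht x y
  rw [Set.ncard_eq_toFinset_card _ hfin,
    Finset.card_eq_sum_card_fiberwise (f := fun kj ↦ (kj.1 0, kj.2 0))
      (t := (Finset.Icc 1 ⌊x / t 0⌋₊ ×ˢ Finset.Icc 1 ⌊y / t 0⌋₊).filter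
        (fun p ↦ p.1.Coprime p.2))]
  · refine Finset.sum_congr rfl fun p hp ↦ ?_
    simp only [Finset.mem_filter, Finset.mem_product, Finset.mem_Icc] at hp
    rw [← Set.ncard_coe_finset, eq_comm]
    have hinj : Function.Injective
        (fun kj : (Fin r → ℕ) × (Fin r → ℕ) ↦
          ((Fin.cons p.1 kj.1, Fin.cons p.2 kj.2) : (Fin (r + 1) → ℕ) × (Fin (r + 1) → ℕ))) := by
      rintro ⟨k, j⟩ ⟨k', j'⟩ h
      simpa using h
    rw [← Set.ncard_image_of_injective _ hinj]
    congr 1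
    ext ⟨k, j⟩
    simp only [Set.mem_image, Finset.coe_filter, Set.Finite.mem_toFinset, Set.mem_ofPred_eq,
      Prod.exists, Prod.mk.injEq]
    constructor
    · rintro ⟨k', j', h, rfl, rfl⟩
      exact ⟨cons_mem_coprimePairs_iff.2 ⟨⟨hp.1.1.1, hp.1.2.1, hp.2⟩, h⟩, by simp⟩
    · rintro ⟨h, h0⟩
      rw [← Fin.cons_self_tail k, ← Fin.cons_self_tail j, cons_mem_coprimePairs_iff] at h
      rw [← h0]
      exact ⟨Fin.tail k, Fin.tail j, h.2, Fin.cons_self_tail k, Fin.cons_self_tail j⟩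
  · intro kj h
    have h' : kj ∈ coprimePairs t x y := by simpa using h
    simp only [Finset.coe_filter, Finset.mem_product, Finset.mem_Icc, Set.mem_ofPred_eq]
    exact ⟨⟨⟨h'.1 0, le_floor_div_of_sum_mul_le ht h'.2.2.1 0⟩, h'.2.1 0,
      le_floor_div_of_sum_mul_le ht h'.2.2.2.1 0⟩, h'.2.2.2.2 0⟩

lemma exists_abs_ncard_coprimePairs_sub_mul_le (r : ℕ) (t : Fin r → ℝ) (ht : ∀ i, 0 < t i) :
    ∃ C ≥ 0, ∀ M x y : ℝ, 3 ≤ M → 0 ≤ x → 0 ≤ y → x ≤ M → y ≤ M →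
      |((coprimePairs t x y).ncard : ℝ) -
        1 / ((r.factorial : ℝ) ^ 2 * (Real.pi ^ 2 / 6) ^ r) * (∏ i, 1 / t i ^ 2) *
          (x ^ r * y ^ r)| * M ≤ C * (M ^ (2 * r) * Real.log M) := by
  induction r with
  | zero =>
    refine ⟨0, le_rfl, fun M x y _ hx hy _ _ ↦ ?_⟩
    have : coprimePairs t x y = Set.univ := by
      ext
      simp [coprimePairs, hx, hy]
    rw [this]
    simp [Set.ncard_univ]
  | succ r ih =>
    obtain ⟨C, hC0, hC⟩ := ih (Fin.tail t) fun i ↦ ht i.succ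
    have ht0 := ht 0
    set c : ℝ := 1 / ((r.factorial : ℝ) ^ 2 * (Real.pi ^ 2 / 6) ^ r) *
      ∏ i, 1 / Fin.tail t i ^ 2 with hc
    have hc0 : 0 ≤ c := by positivity
    refine ⟨C / t 0 ^ 2 + c * (2 / t 0 * (3 + |Real.log (t 0)|)), by positivity,
      fun M x y hM hx hy hxM hyM ↦ ?_⟩
    have hM0 : 0 < M := by linarith
    have hlog : 0 ≤ Real.log M := Real.log_nonneg (by linarith)
    have hmain := abs_sum_coprime_pow_mul_pow_sub_le r ht0 hM hx hy hxM hyM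
    rw [ncard_coprimePairs_succ ht]
    set T := (Finset.Icc 1 ⌊x / t 0⌋₊ ×ˢ Finset.Icc 1 ⌊y / t 0⌋₊).filter
      (fun p ↦ p.1.Coprime p.2) with hT
    have hfloor : ∀ u : ℝ, 0 ≤ u → u ≤ M → (⌊u / t 0⌋₊ : ℝ) ≤ M / t 0 := fun u hu huM ↦
      (Nat.floor_le (by positivity)).trans (by gcongr)
    have hcard : (T.card : ℝ) ≤ M / t 0 * (M / t 0) := by
      have h : T.card ≤ ⌊x / t 0⌋₊ * ⌊y / t 0⌋₊ := by
        simpa using Finset.card_filter_le (Finset.Icc 1 ⌊x / t 0⌋₊ ×ˢ Finset.Icc 1 ⌊y / t 0⌋₊)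
          (fun p ↦ p.1.Coprime p.2)
      calc (T.card : ℝ) ≤ ⌊x / t 0⌋₊ * ⌊y / t 0⌋₊ := by exact_mod_cast h
        _ ≤ _ := mul_le_mul (hfloor x hx hxM) (hfloor y hy hyM) (by positivity) (by positivity)
    have herr : |∑ p ∈ T, (((coprimePairs (Fin.tail t) (x - p.1 * t 0) (y - p.2 * t 0)).ncard : ℝ) -
        c * ((x - p.1 * t 0) ^ r * (y - p.2 * t 0) ^ r))| * M ≤
        M / t 0 * (M / t 0) * (C * (M ^ (2 * r) * Real.log M)) := by
      refine le_trans ?_ (mul_le_mul_of_nonneg_right hcard (by positivity))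
      rw [← nsmul_eq_mul]
      refine (mul_le_mul_of_nonneg_right (Finset.abs_sum_le_sum_abs _ _) hM0.le).trans ?_
      rw [Finset.sum_mul]
      refine Finset.sum_le_card_nsmul _ _ _ fun p hp ↦ ?_
      simp only [hT, Finset.mem_filter, Finset.mem_product, Finset.mem_Icc,
        Nat.le_floor_iff (div_nonneg hx ht0.le), Nat.le_floor_iff (div_nonneg hy ht0.le),
        le_div_iff₀ ht0] at hp
      have hp1 : 0 ≤ p.1 * t 0 := by positivity
      have hp2 : 0 ≤ p.2 * t 0 := by positivity
      exact hC M _ _ hM (by linarith [hp.1.1.2]) (by linarith [hp.1.2.2]) (by linarith)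
        (by linarith)
    rw [Finset.sum_sub_distrib, ← Finset.mul_sum] at herr
    push_cast
    set N : ℝ := ∑ p ∈ T, ((coprimePairs (Fin.tail t) (x - p.1 * t 0) (y - p.2 * t 0)).ncard : ℝ)
    set F : ℝ := ∑ p ∈ T, (x - p.1 * t 0) ^ r * (y - p.2 * t 0) ^ r
    set G : ℝ := (Real.pi ^ 2 / 6)⁻¹ / ((r + 1) ^ 2 * t 0 ^ 2) * (x ^ (r + 1) * y ^ (r + 1))
      with hG
    have hcG : 1 / (((r + 1).factorial : ℝ) ^ 2 * (Real.pi ^ 2 / 6) ^ (r + 1)) *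
        (∏ i, 1 / t i ^ 2) * (x ^ (r + 1) * y ^ (r + 1)) = c * G := by
      rw [hc, hG, Fin.prod_univ_succ, Nat.factorial_succ]
      simp only [Fin.tail]
      push_cast
      field_simp
      ring
    rw [hcG]
    calc |N - c * G| * M = |(N - c * F) + c * (F - G)| * M := by ring_nf
      _ ≤ (|N - c * F| + c * |F - G|) * M := by
        gcongr
        refine (abs_add_le _ _).trans_eq ?_
        rw [abs_mul, abs_of_nonneg hc0]
      _ = |N - c * F| * M + c * |F - G| * M := add_mul _ _ _
      _ ≤ M / t 0 * (M / t 0) * (C * (M ^ (2 * r) * Real.log M)) +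
          c * (2 / t 0 * (3 + |Real.log (t 0)|) * (M ^ (2 * r + 1) * Real.log M)) * M := by
        gcongr
      _ = _ := by
        field_simp
        ring


/-- **Lemma 3.** For fixed `r ≥ 1` and fixed reals `t 1, ..., t r > 0`, for `z ≥ 3`,
the number of pairs of `r`-tuples `((k 1, ..., k r), (j 1, ..., j r))` of positive
integers with `k 1 * t 1 + ⋯ + k r * t r ≤ z`, `j 1 * t 1 + ⋯ + j r * t r ≤ z` and
`gcd (k i) (j i) = 1` for all `i` equals
`(1/((r!)² ζ(2)^r)) (∏ i, 1/(t i)²) z^{2r} + O(z^{2r-1} log z)`, where `ζ(2) = π²/6`. -/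
theorem coprime_lattice_pairs_count_asymptotic
    (r : ℕ) (hr : 1 ≤ r) (t : Fin r → ℝ) (ht : ∀ i, 0 < t i) :
    ∃ C > 0, ∀ z : ℝ, 3 ≤ z →
      |(Set.ncard {kj : (Fin r → ℕ) × (Fin r → ℕ) |
            (∀ i, 1 ≤ kj.1 i) ∧ (∀ i, 1 ≤ kj.2 i) ∧
            (∑ i, (kj.1 i : ℝ) * t i) ≤ z ∧
            (∑ i, (kj.2 i : ℝ) * t i) ≤ z ∧
            ∀ i, Nat.Coprime (kj.1 i) (kj.2 i)} : ℝ) -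
          (1 / ((r.factorial : ℝ) ^ 2 * (Real.pi ^ 2 / 6) ^ r)) *
            (∏ i, 1 / t i ^ 2) * z ^ (2 * r)| ≤
        C * z ^ (2 * r - 1) * Real.log z := by
  obtain ⟨C, hC0, hC⟩ := exists_abs_ncard_coprimePairs_sub_mul_le r t ht
  refine ⟨C + 1, by linarith, fun z hz ↦ ?_⟩
  have hz0 : 0 < z := by linarith
  have hlog : 0 ≤ Real.log z := Real.log_nonneg (by linarith)
  have h := hC z z z hz hz0.le hz0.le le_rfl le_rfl
  rw [← pow_add, ← two_mul] at h
  refine le_of_mul_le_mul_right (h.trans ?_) hz0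
  have hpow : z ^ (2 * r) = z ^ (2 * r - 1) * z := by
    rw [← pow_succ]
    congr 1
    omega
  rw [hpow]
  have : 0 ≤ z ^ (2 * r - 1) * z * Real.log z := by positivity
  linarith
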